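/- Let K be a convex body in ℝ^n with centroid σ(K), let ϱ > 0 be maximal with σ(K) + ϱB^n ⊂ K and let R > 0 be minimal with K ⊂ σ(K) + RB^n. Then the volume of K satisfies V(K) ≤ (n+1) κ_{n-1} ϱ R^{n-1}. -/

import Mathlib

open MeasureTheory Metric Set Filter
open scoped ENNReal RealInnerProductSpace NNReal

noncomputable section

abbrev Eu (n : ℕ) : Type := EuclideanSpace ℝ (Fin n)

def IsConvexBody {n : ℕ} (K : Set (Eu n)) : Prop :=
  Convex ℝ K ∧ IsCompact K ∧ (interior K).Nonempty

def suppFn {n : ℕ} (K : Set (Eu n)) (u : Eu n) : ℝ :=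
  sSup ((fun x => ⟪x, u⟫) '' K)

def IsOuterNormal {n : ℕ} (K : Set (Eu n)) (x u : Eu n) : Prop :=
  ‖u‖ = 1 ∧ ∀ y ∈ K, ⟪y, u⟫ ≤ ⟪x, u⟫

def gaussMap {n : ℕ} (K : Set (Eu n)) (x : Eu n) : Eu n :=
  open scoped Classical in
  if h : ∃ u, IsOuterNormal K x u then h.choose else 0

def lpSurf {n : ℕ} (p : ℝ) (K : Set (Eu n)) (ω : Set (Eu n)) : ℝ≥0∞ :=
  ∫⁻ x in {x ∈ frontier K | gaussMap K x ∈ ω},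
    ENNReal.ofReal (⟪x, gaussMap K x⟫ ^ (1 - p)) ∂(μH[(n:ℝ) - 1])


/-- The centroid of a convex body. -/
def centroid {n : ℕ} (K : Set (Eu n)) : Eu n :=
  (volume K).toReal⁻¹ • ∫ x in K, x

/-- If `f` is concave and nonnegative on `K`, the cones with apex `p` over `K` lie in the
superlevel sets of `f`, so the mean of `f` over `K` is at least `f p / (d + 1)`. -/
theorem ConcaveOn.mul_measureReal_le_setIntegral {E : Type*} [NormedAddCommGroup E]
    [NormedSpace ℝ E] [MeasurableSpace E] [BorelSpace E] [FiniteDimensional ℝ E]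
    {μ : Measure E} [μ.IsAddHaarMeasure] {K : Set E} {f : E → ℝ} (hf : ConcaveOn ℝ K f)
    (hK : MeasurableSet K) (hfi : IntegrableOn f K μ)
    (h0 : ∀ x ∈ K, 0 ≤ f x) {p : E} (hp : p ∈ K) :
    f p * μ.real K ≤ (Module.finrank ℝ E + 1) * ∫ x in K, f x ∂μ := by
  set d := Module.finrank ℝ E
  have h0' : 0 ≤ᵐ[μ.restrict K] f := by
    filter_upwards [ae_restrict_mem hK] with x hx using h0 x hx
  have hint0 : 0 ≤ ∫ x in K, f x ∂μ := integral_nonneg_of_ae h0'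
  rcases (h0 p hp).eq_or_lt with hM | hM
  · rw [← hM, zero_mul]; positivity
  set M := f p with hMdef
  have level : ∀ t ∈ Ioc 0 M, ENNReal.ofReal ((1 - t / M) ^ d) * μ K ≤
      μ.restrict K {a | t ≤ f a} := by
    intro t ht
    have hs0 : 0 ≤ t / M := div_nonneg ht.1.le hM.le
    have hs1 : 0 ≤ 1 - t / M := sub_nonneg.2 ((div_le_one hM).2 ht.2)
    rw [Measure.restrict_apply' hK, ← abs_of_nonneg (pow_nonneg hs1 d),
      ← Measure.addHaar_image_homothety μ p]
    refine measure_mono ?_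
    rintro _ ⟨x, hx, rfl⟩
    have e : AffineMap.homothety p (1 - t / M) x = (t / M) • p + (1 - t / M) • x := by
      simp only [AffineMap.homothety_apply, vsub_eq_sub, vadd_eq_add]; module
    rw [e]
    refine ⟨?_, hf.1 hp hx hs0 hs1 (by ring)⟩
    have := hf.2 hp hx hs0 hs1 (by ring)
    simp only [smul_eq_mul] at this
    have h2 := mul_nonneg hs1 (h0 x hx)
    have h3 : t / M * f p = t := div_mul_cancel₀ t hM.ne'
    simp only [mem_ofPred_eq]
    linarith
  have hprofile : ∫ t in Ioc 0 M, (1 - t / M) ^ d = M / (d + 1) := by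
    rw [← intervalIntegral.integral_of_le hM.le,
      intervalIntegral.integral_comp_sub_div (fun x : ℝ => x ^ d) hM.ne' 1, integral_pow]
    simp [hM.ne', div_eq_mul_inv]
  have hprofile' : ∫⁻ t in Ioc 0 M, ENNReal.ofReal ((1 - t / M) ^ d) =
      ENNReal.ofReal (M / (d + 1)) := by
    rw [← hprofile, ofReal_integral_eq_lintegral_ofReal]
    · exact (Continuous.integrableOn_Icc (by fun_prop)).mono_set Ioc_subset_Icc_self
    · filter_upwards [ae_restrict_mem measurableSet_Ioc] with t ht
      exact pow_nonneg (sub_nonneg.2 ((div_le_one hM).2 ht.2)) d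
  have key : ENNReal.ofReal (M / (d + 1)) * μ K ≤ ENNReal.ofReal (∫ x in K, f x ∂μ) := by
    rw [ofReal_integral_eq_lintegral_ofReal hfi h0',
      lintegral_eq_lintegral_meas_le _ h0' hfi.aestronglyMeasurable.aemeasurable,
      ← hprofile', ← lintegral_mul_const _ (by fun_prop)]
    exact (setLIntegral_mono' measurableSet_Ioc level).trans
      (lintegral_mono_set Ioc_subset_Ioi_self)
  have := ENNReal.toReal_mono ENNReal.ofReal_ne_top key
  rw [ENNReal.toReal_mul, ENNReal.toReal_ofReal hint0, ENNReal.toReal_ofReal (by positivity),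
    div_mul_eq_mul_div, div_le_iff₀ (by positivity)] at this
  rw [mul_comm (_ + _)]
  exact this

/-- If a ball contained in a convex body cannot be enlarged, then some supporting hyperplane of the
body is tangent to it. -/
theorem Convex.exists_unit_inner_sub_le_of_closedBall {E : Type*} [NormedAddCommGroup E]
    [InnerProductSpace ℝ E] [FiniteDimensional ℝ E] {K : Set E} (hK : Convex ℝ K)
    (hint : (interior K).Nonempty) {c : E} {ϱ : ℝ} (hϱ : 0 ≤ ϱ)
    (hmax : ∀ r > ϱ, ¬ closedBall c r ⊆ K) :
    ∃ u : E, ‖u‖ = 1 ∧ ∀ x ∈ K, ⟪u, x - c⟫ ≤ ϱ := by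
  obtain ⟨y, hyb, hyK⟩ : ∃ y ∈ closedBall c ϱ, y ∉ interior K := by
    by_contra! h
    obtain ⟨δ, hδ, hsub⟩ :=
      (isCompact_closedBall c ϱ).exists_cthickening_subset_open isOpen_interior h
    rw [cthickening_closedBall hδ.le hϱ] at hsub
    exact hmax (δ + ϱ) (by linarith) (hsub.trans interior_subset)
  obtain ⟨f, hf⟩ := geometric_hahn_banach_open_point hK.interior isOpen_interior hyK
  have hfK : ∀ x ∈ K, f x ≤ f y := by
    intro x hx
    have hx' : x ∈ closure (interior K) := by
      rw [hK.closure_interior_eq_closure_of_nonempty_interior hint]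
      exact subset_closure hx
    exact closure_minimal (fun a ha => (hf a ha).le)
      (isClosed_le f.continuous continuous_const) hx'
  set v := (InnerProductSpace.toDual ℝ E).symm f
  have hv : ∀ x, ⟪v, x⟫ = f x := fun x => InnerProductSpace.toDual_symm_apply
  have hv0 : v ≠ 0 := by
    obtain ⟨a, ha⟩ := hint
    intro h
    have := hf a ha
    rw [← hv, ← hv, h] at this
    simp at this
  have hvn : 0 < ‖v‖ := norm_pos_iff.2 hv0
  refine ⟨‖v‖⁻¹ • v, norm_smul_inv_norm hv0, fun x hx => ?_⟩
  have h1 : ⟪v, x - c⟫ ≤ ⟪v, y - c⟫ := by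
    rw [inner_sub_right, inner_sub_right, hv, hv, hv]
    exact sub_le_sub_right (hfK x hx) _
  have h2 : ⟪v, y - c⟫ ≤ ‖v‖ * ϱ :=
    (real_inner_le_norm _ _).trans
      (mul_le_mul_of_nonneg_left (mem_closedBall_iff_norm.1 hyb) hvn.le)
  rw [real_inner_smul_left, inv_mul_le_iff₀ hvn]
  exact h1.trans h2

/-- A subset of a ball of radius `R` lying between two hyperplanes orthogonal to `u` has volume at
most that of the cylinder over an `m`-dimensional ball of radius `R` that contains it. -/
theorem volume_le_of_subset_slab_inter_closedBall {m : ℕ} {K : Set (Eu (m + 1))}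
    {c u : Eu (m + 1)} (hu : ‖u‖ = 1) {a b R : ℝ} (hR : 0 ≤ R)
    (hslab : ∀ x ∈ K, ⟪u, x - c⟫ ∈ Icc a b) (hball : K ⊆ closedBall c R) :
    volume K ≤ ENNReal.ofReal (b - a) *
      (ENNReal.ofReal (R ^ m) * volume (closedBall (0 : Eu m) 1)) := by
  obtain ⟨B, hB⟩ := Orthonormal.exists_orthonormalBasis_extension_of_card_eq
    (𝕜 := ℝ) (E := Eu (m + 1)) (ι := Fin (m + 1)) (by simp) (v := fun _ => u) (s := {0})
    (by
      rw [orthonormal_iff_ite]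
      rintro ⟨i, rfl⟩ ⟨j, rfl⟩
      simp [hu])
  have hB0 : B 0 = u := hB 0 rfl
  have mp1 := B.measurePreserving_repr.comp
    (measurePreserving_sub_right (volume : Measure (Eu (m + 1))) c)
  have mp2 := (PiLp.volume_preserving_ofLp (Fin (m + 1))).comp mp1
  have mp3 := (volume_preserving_piFinSuccAbove (fun _ : Fin (m + 1) => ℝ) 0).comp mp2
  have mp4 := ((MeasurePreserving.id (volume : Measure ℝ)).prod
    (PiLp.volume_preserving_toLp (Fin m))).comp mp3
  have hsub : K ⊆ (Prod.map id (WithLp.toLp 2) ∘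
      ⇑(MeasurableEquiv.piFinSuccAbove (fun _ : Fin (m + 1) => ℝ) 0) ∘ WithLp.ofLp ∘ ⇑B.repr ∘
        fun x => x - c) ⁻¹' (Icc a b ×ˢ closedBall (0 : Eu m) R) := by
    intro x hx
    have h0 : (B.repr (x - c)) 0 = ⟪u, x - c⟫ := by rw [B.repr_apply_apply, hB0]
    refine ⟨?_, ?_⟩
    · show (B.repr (x - c)) 0 ∈ Icc a b
      rw [h0]
      exact hslab x hx
    · have h1 : ‖B.repr (x - c)‖ ≤ R := by
        rw [LinearIsometryEquiv.norm_map]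
        exact mem_closedBall_iff_norm.1 (hball hx)
      rw [mem_closedBall_zero_iff]
      refine le_trans ?_ h1
      rw [EuclideanSpace.norm_eq, EuclideanSpace.norm_eq, Fin.sum_univ_succ]
      exact Real.sqrt_le_sqrt (le_add_of_nonneg_left (sq_nonneg _))
  calc volume K ≤ _ := measure_mono hsub
    _ = _ := mp4.measure_preimage
      (measurableSet_Icc.prod measurableSet_closedBall).nullMeasurableSet
    _ = _ := by
      rw [Measure.prod_prod, Real.volume_Icc]
      congr 1
      simpa using Measure.addHaar_closedBall_mul volume (0 : Eu m) hR zero_le_one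

theorem IsConvexBody.measurableSet {n : ℕ} {K : Set (Eu n)} (hK : IsConvexBody K) :
    MeasurableSet K :=
  hK.2.1.isClosed.measurableSet

theorem IsConvexBody.volume_real_pos {n : ℕ} {K : Set (Eu n)} (hK : IsConvexBody K) :
    0 < volume.real K :=
  ENNReal.toReal_pos (Measure.measure_pos_of_nonempty_interior _ hK.2.2).ne' hK.2.1.measure_lt_top.ne

theorem IsConvexBody.setIntegral_inner_sub_centroid {n : ℕ} {K : Set (Eu n)}
    (hK : IsConvexBody K) (u : Eu n) : ∫ x in K, ⟪u, x - centroid K⟫ = 0 := by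
  have hid : IntegrableOn (fun x : Eu n => x) K := continuous_id.continuousOn.integrableOn_compact
    hK.2.1
  have hc : IntegrableOn (fun _ : Eu n => centroid K) K :=
    continuous_const.continuousOn.integrableOn_compact hK.2.1
  rw [integral_inner (f := fun x => x - centroid K) (hid.sub hc), integral_sub hid hc, setIntegral_const, centroid,
    smul_smul, ← Measure.real_def, mul_inv_cancel₀ hK.volume_real_pos.ne']
  simp

/-- In every direction, the distances of the centroid from the two supporting hyperplanes have
ratio at most the dimension. -/
theorem IsConvexBody.neg_mul_le_inner_sub_centroid {n : ℕ} {K : Set (Eu n)}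
    (hK : IsConvexBody K) {u : Eu n} {ϱ : ℝ} (h : ∀ x ∈ K, ⟪u, x - centroid K⟫ ≤ ϱ)
    {p : Eu n} (hp : p ∈ K) : -(n * ϱ) ≤ ⟪u, p - centroid K⟫ := by
  have hcont : Continuous fun x : Eu n => ⟪u, x - centroid K⟫ := by fun_prop
  have hint := hcont.continuousOn.integrableOn_compact (μ := volume) hK.2.1
  have hconst := (continuous_const (y := ϱ)).continuousOn.integrableOn_compact
    (μ := (volume : Measure (Eu n))) hK.2.1
  have hconc : ConcaveOn ℝ K fun x => ϱ - ⟪u, x - centroid K⟫ := by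
    refine ⟨hK.1, fun x _ y _ a b _ _ hab => le_of_eq ?_⟩
    obtain rfl : b = 1 - a := by linarith
    simp only [inner_sub_right, inner_add_right, inner_smul_right, smul_eq_mul]
    ring
  have key := hconc.mul_measureReal_le_setIntegral (μ := volume) hK.measurableSet
    (hconst.sub hint) (fun x hx => sub_nonneg.2 (h x hx)) hp
  rw [integral_sub hconst hint, hK.setIntegral_inner_sub_centroid, setIntegral_const, smul_eq_mul,
    sub_zero, finrank_euclideanSpace_fin, ← mul_assoc, mul_right_comm] at key
  have := le_of_mul_le_mul_right key hK.volume_real_pos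
  linarith

/-- Lemma 2.1 (iii): if `ϱ` is maximal with `σ(K) + ϱBⁿ ⊆ K` and `R` is
minimal with `K ⊆ σ(K) + RBⁿ`, then `V(K) ≤ (n+1) κ_{n-1} ϱ R^{n-1}`. -/
theorem volume_le_of_inradius_circumradius
    (n : ℕ) (K : Set (Eu n)) (hK : IsConvexBody K) (ϱ R : ℝ)
    (hϱ : IsGreatest {r : ℝ | 0 < r ∧ closedBall (centroid K) r ⊆ K} ϱ)
    (hR : IsLeast {r : ℝ | 0 < r ∧ K ⊆ closedBall (centroid K) r} R) :
    (volume K).toReal ≤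
      ((n : ℝ) + 1) * (volume (closedBall (0 : Eu (n - 1)) 1)).toReal * ϱ * R ^ (n - 1) := by
  obtain ⟨⟨hϱ0, -⟩, hmax⟩ := hϱ
  obtain ⟨⟨hR0, hKR⟩, -⟩ := hR
  have hmax' : ∀ r > ϱ, ¬ closedBall (centroid K) r ⊆ K := fun r hr hsub =>
    (hmax ⟨hϱ0.trans hr, hsub⟩).not_gt hr
  obtain ⟨u, hu, hle⟩ := hK.1.exists_unit_inner_sub_le_of_closedBall hK.2.2 hϱ0.le hmax'
  obtain _ | m := n
  · simp [Subsingleton.elim u 0] at hu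
  have hvol := ENNReal.toReal_mono (ENNReal.mul_ne_top ENNReal.ofReal_ne_top
      (ENNReal.mul_ne_top ENNReal.ofReal_ne_top measure_closedBall_lt_top.ne))
    (volume_le_of_subset_slab_inter_closedBall hu hR0.le
      (fun x hx => ⟨hK.neg_mul_le_inner_sub_centroid hle hx, hle x hx⟩) hKR)
  refine hvol.trans (le_of_eq ?_)
  rw [ENNReal.toReal_mul, ENNReal.toReal_mul, ENNReal.toReal_ofReal (by rw [sub_neg_eq_add]; positivity),
    ENNReal.toReal_ofReal (by positivity)]
  simp only [Nat.add_sub_cancel]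
  ring

end
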